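/- arXiv:2304.04094 — 6 statements merged into one kernel-verified Lean document; each statement's English description precedes it below -/
import Mathlib

section
/- Let β_j ∈ (0,1), β_i = 1 − β_j, and c, σ² > 0. Then the function (t,E) ↦ t·log₂(1 + β_i·c·E/(β_j·c·E + σ²·t)) is concave on the convex set {(t,E) ∈ ℝ² : t > 0, E ≥ 0}. -/
/-- The perspective `(t, x) ↦ t * g (x / t)` of a function concave on `[0, ∞)` is concave. -/
lemma ConcaveOn.perspective_Ici {g : ℝ → ℝ} (hg : ConcaveOn ℝ (Set.Ici 0) g) :
    ConcaveOn ℝ {p : ℝ × ℝ | 0 < p.1 ∧ 0 ≤ p.2} (fun p : ℝ × ℝ => p.1 * g (p.2 / p.1)) := by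
  have hconv : Convex ℝ {p : ℝ × ℝ | 0 < p.1 ∧ 0 ≤ p.2} :=
    (convex_Ioi (0 : ℝ)).prod (convex_Ici (0 : ℝ))
  refine ⟨hconv, ?_⟩
  rintro ⟨t, x⟩ hp ⟨s, y⟩ hq a b ha hb hab
  have hT := (hconv hp hq ha hb hab).1
  obtain ⟨ht, hx⟩ := hp
  obtain ⟨hs, hy⟩ := hq
  simp only [smul_eq_mul, Prod.smul_mk, Prod.mk_add_mk] at ht hx hs hy hT ⊢
  have key := hg.2 (Set.mem_Ici.2 (div_nonneg hx ht.le)) (Set.mem_Ici.2 (div_nonneg hy hs.le))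
    (div_nonneg (mul_nonneg ha ht.le) hT.le) (div_nonneg (mul_nonneg hb hs.le) hT.le)
    (by rw [← add_div, div_self hT.ne'])
  simp only [smul_eq_mul] at key
  have hpt : a * t / (a * t + b * s) * (x / t) + b * s / (a * t + b * s) * (y / s)
      = (a * x + b * y) / (a * t + b * s) := by
    field_simp
  rw [hpt] at key
  calc a * (t * g (x / t)) + b * (s * g (y / s))
      = (a * t + b * s) * (a * t / (a * t + b * s) * g (x / t)
          + b * s / (a * t + b * s) * g (y / s)) := by field_simp
    _ ≤ _ := mul_le_mul_of_nonneg_left key hT.le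

lemma concaveOn_mul_div_add {A k σ : ℝ} (hA : 0 ≤ A) (hk : 0 ≤ k) (hσ : 0 < σ) :
    ConcaveOn ℝ (Set.Ici 0) (fun x : ℝ => A * x / (k * x + σ)) := by
  refine ⟨convex_Ici 0, ?_⟩
  intro x hx y hy a b ha hb hab
  rw [Set.mem_Ici] at hx hy
  simp only [smul_eq_mul]
  have hP : 0 < k * x + σ := by positivity
  have hQ : 0 < k * y + σ := by positivity
  have hR : 0 < k * (a * x + b * y) + σ := by positivity
  obtain rfl : b = 1 - a := by linarith
  rw [← sub_nonneg]
  have hgap : A * (a * x + (1 - a) * y) / (k * (a * x + (1 - a) * y) + σ) -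
      (a * (A * x / (k * x + σ)) + (1 - a) * (A * y / (k * y + σ))) =
      A * (a * (1 - a)) * k * σ * (x - y) ^ 2 /
        ((k * (a * x + (1 - a) * y) + σ) * (k * x + σ) * (k * y + σ)) := by
    field_simp
    ring
  rw [hgap]
  positivity

lemma ConcaveOn.logb {f : ℝ → ℝ} {s : Set ℝ} {b : ℝ} (hb : 1 < b) (hf : ConcaveOn ℝ s f)
    (hpos : ∀ x ∈ s, 0 < f x) : ConcaveOn ℝ s (fun x => Real.logb b (f x)) := by
  have hlog : ConcaveOn ℝ s (fun x => Real.log (f x)) := by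
    refine ⟨hf.1, fun x hx y hy u v hu hv huv => ?_⟩
    have hmid := (convex_Ioi (0 : ℝ)) (hpos x hx) (hpos y hy) hu hv huv
    exact (strictConcaveOn_log_Ioi.concaveOn.2 (hpos x hx) (hpos y hy) hu hv huv).trans
      (Real.log_le_log hmid (hf.2 hx hy hu hv huv))
  have h := hlog.smul (inv_nonneg.2 (Real.log_pos hb).le)
  simpa only [Real.logb, smul_eq_mul, div_eq_inv_mul] using h


/-- For NOMA fractions `βj ∈ (0,1)`, `βi = 1 - βj`, beam gain `c > 0` and noise power
`σ² > 0`, the function `(t, E) ↦ t * log₂ (1 + βi * c * E / (βj * c * E + σ² * t))`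
is concave on the convex set `{(t, E) : t > 0, E ≥ 0}`. -/
theorem sinr_bits_perspective_concave (βj βi c σ2 : ℝ)
    (hβj : βj ∈ Set.Ioo (0 : ℝ) 1) (hβi : βi = 1 - βj) (hc : 0 < c) (hσ : 0 < σ2) :
    ConcaveOn ℝ {p : ℝ × ℝ | 0 < p.1 ∧ 0 ≤ p.2}
      (fun p : ℝ × ℝ =>
        p.1 * Real.logb 2 (1 + βi * c * p.2 / (βj * c * p.2 + σ2 * p.1))) := by
  obtain ⟨h0, h1⟩ := hβj
  have hA : 0 ≤ βi * c := mul_nonneg (by linarith) hc.le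
  have hk : 0 ≤ βj * c := (mul_pos h0 hc).le
  have hsinr : ConcaveOn ℝ (Set.Ici 0)
      (fun x : ℝ => 1 + βi * c * x / (βj * c * x + σ2)) :=
    (concaveOn_const 1 (convex_Ici 0)).add (concaveOn_mul_div_add hA hk hσ)
  have hrate := hsinr.logb one_lt_two fun x hx => by
    have hx : 0 ≤ x := hx
    positivity
  refine hrate.perspective_Ici.congr ?_
  rintro ⟨t, x⟩ ⟨ht, hx⟩
  simp only at ht hx ⊢
  congr 3
  field_simp
end

section
/- Fix W, σ², g, c, T > 0, K ≥ 1, L_j, L_i ≥ 0, β_j ∈ (0,1), and β_i = 1 − β_j. The feasible set of problem (P2), namely the set of quadruples (t_j, t_i, E_j, E_i) with t_j, t_i > 0 and E_j, E_i ≥ 0 satisfying (i) t_j·W·log₂(1 + E_j·g/(σ²·t_j)) ≥ L_j, (ii) t_i·W·log₂(1 + β_j·E_i·c/(σ²·t_i)) ≥ L_j, (iii) t_i·W·log₂(1 + β_i·E_i·c/(β_j·E_i·c + σ²·t_i)) ≥ L_i, and (iv) t_j + t_i ≤ T/K, is a convex subset of ℝ⁴. Consequently problem (P2), which minimizes the linear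 objective E_j + E_i over this set, is a convex optimization problem. -/
/-- The linear fractional map `s ↦ 1 + p s / (q s + r)` is concave on the nonnegative reals. -/
theorem concaveOn_one_add_mul_div {p q r : ℝ} (hp : 0 ≤ p) (hq : 0 ≤ q) (hr : 0 < r) :
    ConcaveOn ℝ (Set.Ici 0) fun s : ℝ => 1 + p * s / (q * s + r) := by
  refine ⟨convex_Ici 0, fun x hx y hy a b ha hb hab => ?_⟩
  simp only [Set.mem_Ici] at hx hy
  simp only [smul_eq_mul]
  have hX : 0 < q * x + r := by positivity
  have hY : 0 < q * y + r := by positivity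
  have hM : 0 < q * (a * x + b * y) + r := by positivity
  obtain rfl : b = 1 - a := by linarith
  have key : 1 + p * (a * x + (1 - a) * y) / (q * (a * x + (1 - a) * y) + r)
      - (a * (1 + p * x / (q * x + r)) + (1 - a) * (1 + p * y / (q * y + r)))
      = p * (a * (1 - a) * (q * r * (x - y) ^ 2))
        / ((q * x + r) * (q * y + r) * (q * (a * x + (1 - a) * y) + r)) := by
    have := hX.ne'
    have := hY.ne'
    have := hM.ne'
    field_simp
    ring
  rw [← sub_nonneg, key]
  positivity

/-- The rate function `s ↦ log₂ (1 + p s / (q s + r))` is concave on the nonnegative reals. -/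
theorem concaveOn_logb_one_add_mul_div {p q r : ℝ} (hp : 0 ≤ p) (hq : 0 ≤ q) (hr : 0 < r) :
    ConcaveOn ℝ (Set.Ici 0) fun s : ℝ => Real.logb 2 (1 + p * s / (q * s + r)) := by
  refine ⟨convex_Ici 0, fun x hx y hy a b ha hb hab => ?_⟩
  have hfrac := (concaveOn_one_add_mul_div hp hq hr).2 hx hy ha hb hab
  simp only [Set.mem_Ici] at hx hy
  have hX : 0 < 1 + p * x / (q * x + r) := by positivity
  have hY : 0 < 1 + p * y / (q * y + r) := by positivity
  have hlog := strictConcaveOn_log_Ioi.concaveOn.2 (Set.mem_Ioi.2 hX) (Set.mem_Ioi.2 hY) ha hb hab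
  have hpos := (convex_Ioi (0 : ℝ)) (Set.mem_Ioi.2 hX) (Set.mem_Ioi.2 hY) ha hb hab
  have hmono := hlog.trans (Real.log_le_log hpos hfrac)
  simp only [smul_eq_mul, Real.logb] at hmono ⊢
  rw [← mul_div_assoc, ← mul_div_assoc, ← add_div]
  exact div_le_div_of_nonneg_right hmono (Real.log_nonneg one_le_two)

/-- The perspective `(t, E) ↦ t f (E / t)` of a concave function is concave. -/
theorem ConcaveOn.perspective_le {f : ℝ → ℝ} (hf : ConcaveOn ℝ (Set.Ici 0) f)
    {t₁ t₂ E₁ E₂ a b : ℝ} (ht₁ : 0 < t₁) (ht₂ : 0 < t₂) (hE₁ : 0 ≤ E₁) (hE₂ : 0 ≤ E₂)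
    (ha : 0 ≤ a) (hb : 0 ≤ b) (ht : 0 < a * t₁ + b * t₂) :
    a * (t₁ * f (E₁ / t₁)) + b * (t₂ * f (E₂ / t₂))
      ≤ (a * t₁ + b * t₂) * f ((a * E₁ + b * E₂) / (a * t₁ + b * t₂)) := by
  have h := hf.2 (Set.mem_Ici.2 (div_nonneg hE₁ ht₁.le)) (Set.mem_Ici.2 (div_nonneg hE₂ ht₂.le))
    (show 0 ≤ a * t₁ / (a * t₁ + b * t₂) by positivity)
    (show 0 ≤ b * t₂ / (a * t₁ + b * t₂) by positivity) (by rw [← add_div, div_self ht.ne'])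
  simp only [smul_eq_mul] at h
  have harg : a * t₁ / (a * t₁ + b * t₂) * (E₁ / t₁) + b * t₂ / (a * t₁ + b * t₂) * (E₂ / t₂)
      = (a * E₁ + b * E₂) / (a * t₁ + b * t₂) := by
    field_simp
  rw [harg] at h
  calc a * (t₁ * f (E₁ / t₁)) + b * (t₂ * f (E₂ / t₂))
      = (a * t₁ + b * t₂) * (a * t₁ / (a * t₁ + b * t₂) * f (E₁ / t₁)
          + b * t₂ / (a * t₁ + b * t₂) * f (E₂ / t₂)) := by
        field_simp
    _ ≤ _ := mul_le_mul_of_nonneg_left h ht.le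

/-- The offloading constraint `t W log₂ (1 + p E / (q E + r t)) ≥ L` is preserved under convex
combinations. -/
theorem offloading_constraint_combo {W p q r L t₁ t₂ E₁ E₂ a b : ℝ} (hW : 0 ≤ W)
    (hp : 0 ≤ p) (hq : 0 ≤ q) (hr : 0 < r)
    (ht₁ : 0 < t₁) (ht₂ : 0 < t₂) (hE₁ : 0 ≤ E₁) (hE₂ : 0 ≤ E₂)
    (ha : 0 ≤ a) (hb : 0 ≤ b) (hab : a + b = 1)
    (h₁ : L ≤ t₁ * (W * Real.logb 2 (1 + p * E₁ / (q * E₁ + r * t₁))))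
    (h₂ : L ≤ t₂ * (W * Real.logb 2 (1 + p * E₂ / (q * E₂ + r * t₂)))) :
    L ≤ (a * t₁ + b * t₂) * (W * Real.logb 2
      (1 + p * (a * E₁ + b * E₂) / (q * (a * E₁ + b * E₂) + r * (a * t₁ + b * t₂)))) := by
  have scale : ∀ {t E : ℝ}, 0 < t →
      p * (E / t) / (q * (E / t) + r) = p * E / (q * E + r * t) := by
    intro t E ht
    rw [← mul_div_mul_right (p * (E / t)) (q * (E / t) + r) ht.ne']
    congr 1 <;> field_simp
  have ht : 0 < a * t₁ + b * t₂ := (convex_Ioi (0 : ℝ)) ht₁ ht₂ ha hb hab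
  have h := (concaveOn_logb_one_add_mul_div hp hq hr).perspective_le ht₁ ht₂ hE₁ hE₂ ha hb ht
  simp only [scale ht₁, scale ht₂, scale ht] at h
  have hWh := mul_le_mul_of_nonneg_left h hW
  have hL₁ := mul_le_mul_of_nonneg_left h₁ ha
  have hL₂ := mul_le_mul_of_nonneg_left h₂ hb
  have hL : L = a * L + b * L := by rw [← add_mul, hab, one_mul]
  linarith


/-- The feasible set of problem (P2) — quadruples `(t_j, t_i, E_j, E_i)` with
`t_j, t_i > 0`, `E_j, E_i ≥ 0` satisfying the three offloading-requirement
constraints and the latency constraint — is a convex subset of `ℝ⁴`, and the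
linear objective `E_j + E_i` is convex on it, so (P2) is a convex optimization
problem. -/
theorem P2_is_convex (W σ2 g c T : ℝ) (K : ℕ) (Lj Li βj βi : ℝ)
    (hW : 0 < W) (hσ : 0 < σ2) (hg : 0 < g) (hc : 0 < c) (hT : 0 < T)
    (hK : 1 ≤ K) (hLj : 0 ≤ Lj) (hLi : 0 ≤ Li)
    (hβj : βj ∈ Set.Ioo (0 : ℝ) 1) (hβi : βi = 1 - βj) :
    Convex ℝ {v : ℝ × ℝ × ℝ × ℝ |
        0 < v.1 ∧ 0 < v.2.1 ∧ 0 ≤ v.2.2.1 ∧ 0 ≤ v.2.2.2 ∧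
        v.1 * (W * Real.logb 2 (1 + v.2.2.1 * g / (σ2 * v.1))) ≥ Lj ∧
        v.2.1 * (W * Real.logb 2 (1 + βj * v.2.2.2 * c / (σ2 * v.2.1))) ≥ Lj ∧
        v.2.1 * (W * Real.logb 2
            (1 + βi * v.2.2.2 * c / (βj * v.2.2.2 * c + σ2 * v.2.1))) ≥ Li ∧
        v.1 + v.2.1 ≤ T / K} ∧
      ConvexOn ℝ {v : ℝ × ℝ × ℝ × ℝ |
        0 < v.1 ∧ 0 < v.2.1 ∧ 0 ≤ v.2.2.1 ∧ 0 ≤ v.2.2.2 ∧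
        v.1 * (W * Real.logb 2 (1 + v.2.2.1 * g / (σ2 * v.1))) ≥ Lj ∧
        v.2.1 * (W * Real.logb 2 (1 + βj * v.2.2.2 * c / (σ2 * v.2.1))) ≥ Lj ∧
        v.2.1 * (W * Real.logb 2
            (1 + βi * v.2.2.2 * c / (βj * v.2.2.2 * c + σ2 * v.2.1))) ≥ Li ∧
        v.1 + v.2.1 ≤ T / K}
        (fun v : ℝ × ℝ × ℝ × ℝ => v.2.2.1 + v.2.2.2) := by
  have hβj0 : 0 < βj := hβj.1
  have hβi0 : 0 ≤ βi := by linarith [hβj.2]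
  refine (fun hconv => ⟨hconv, hconv, fun x _ y _ a b _ _ _ => ?_⟩) ?_
  · rintro ⟨s₁, t₁, D₁, E₁⟩ ⟨hs₁, ht₁, hD₁, hE₁, hj₁, hij₁, hii₁, hT₁⟩
      ⟨s₂, t₂, D₂, E₂⟩ ⟨hs₂, ht₂, hD₂, hE₂, hj₂, hij₂, hii₂, hT₂⟩ a b ha hb hab
    dsimp only at *
    refine ⟨(convex_Ioi (0 : ℝ)) hs₁ hs₂ ha hb hab, (convex_Ioi (0 : ℝ)) ht₁ ht₂ ha hb hab,
      (convex_Ici (0 : ℝ)) hD₁ hD₂ ha hb hab, (convex_Ici (0 : ℝ)) hE₁ hE₂ ha hb hab,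
      ?_, ?_, ?_, ?_⟩ <;>
    simp only [Prod.fst_add, Prod.snd_add, Prod.smul_fst, Prod.smul_snd, smul_eq_mul]
    · have h := offloading_constraint_combo (L := Lj) (p := g) (q := 0) hW.le hg.le le_rfl hσ
        hs₁ hs₂ hD₁ hD₂ ha hb hab
      simp only [zero_mul, zero_add, mul_comm g] at h
      exact h hj₁ hj₂
    · have h := offloading_constraint_combo (L := Lj) (p := βj * c) (q := 0) hW.le
        (by positivity) le_rfl hσ ht₁ ht₂ hE₁ hE₂ ha hb hab
      simp only [zero_mul, zero_add, mul_right_comm βj c] at h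
      exact h hij₁ hij₂
    · have h := offloading_constraint_combo (L := Li) (p := βi * c) (q := βj * c) hW.le
        (by positivity) (by positivity) hσ ht₁ ht₂ hE₁ hE₂ ha hb hab
      simp only [mul_right_comm _ c] at h
      exact h hii₁ hii₂
    · have hcomb := (convex_Iic (T / K)) hT₁ hT₂ ha hb hab
      simp only [smul_eq_mul, Set.mem_Iic] at hcomb
      linarith
  · simp only [Prod.fst_add, Prod.snd_add, Prod.smul_fst, Prod.smul_snd, smul_eq_mul]
    exact le_of_eq (by ring)
end

section
/- Fix t_j, t_i > 0, g, c, σ² > 0, β_j ∈ (0,1), and β_i = 1 − β_j. The numerator of the CEE objective of problem (P7), namely the function N(p_j, p_i) = t_i·log₂(1 + β_i·p_i·c/(β_j·p_i·c + σ²)) + min{ t_j·log₂(1 + p_j·g/σ²), t_i·log₂(1 + β_j·p_i·c/σ²) }, is concave in (p_j, p_i) on [0,∞)². -/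
/-- The logarithm, to a base greater than one, of a positive concave function is concave. -/
theorem ConcaveOn.logb_comp {E : Type*} [AddCommGroup E] [Module ℝ E] {s : Set E} {f : E → ℝ}
    {B : ℝ} (hB : 1 < B) (hf : ConcaveOn ℝ s f) (hpos : ∀ x ∈ s, 0 < f x) :
    ConcaveOn ℝ s (fun x => Real.logb B (f x)) := by
  refine ⟨hf.1, fun x hx y hy a b ha hb hab => ?_⟩
  have hlog : a * Real.log (f x) + b * Real.log (f y) ≤ Real.log (f (a • x + b • y)) :=
    (strictConcaveOn_log_Ioi.concaveOn.2 (hpos x hx) (hpos y hy) ha hb hab).trans <|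
      Real.log_le_log (convex_Ioi (0 : ℝ) (hpos x hx) (hpos y hy) ha hb hab)
        (hf.2 hx hy ha hb hab)
  have hlogB := Real.log_pos hB
  simp only [Real.logb, smul_eq_mul]
  calc a * (Real.log (f x) / Real.log B) + b * (Real.log (f y) / Real.log B)
      = (a * Real.log (f x) + b * Real.log (f y)) / Real.log B := by ring
    _ ≤ _ := by gcongr

/-- The saturating map `x ↦ x / (β x + σ)` is concave on the nonnegative reals. -/
theorem concaveOn_div_mul_add {β σ : ℝ} (hβ : 0 < β) (hσ : 0 < σ) :
    ConcaveOn ℝ (Set.Ici 0) (fun x : ℝ => x / (β * x + σ)) := by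
  refine ⟨convex_Ici 0, fun x hx y hy a b ha hb hab => ?_⟩
  simp only [Set.mem_Ici] at hx hy
  have hX : 0 < β * x + σ := by positivity
  have hY : 0 < β * y + σ := by positivity
  have hZ : 0 < β * (a * x + b * y) + σ := by positivity
  simp only [smul_eq_mul]
  rw [← sub_nonneg]
  have key : (a * x + b * y) / (β * (a * x + b * y) + σ)
      - (a * (x / (β * x + σ)) + b * (y / (β * y + σ)))
      = a * b * β * σ * (x - y) ^ 2 /
        ((β * x + σ) * (β * y + σ) * (β * (a * x + b * y) + σ)) := by
    obtain rfl : b = 1 - a := by linarith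
    field_simp
    ring
  rw [key]
  positivity


/-- The numerator of the CEE objective of problem (P7),
`N(p_j, p_i) = t_i·log₂(1 + βi·p_i·c/(βj·p_i·c + σ²))
  + min { t_j·log₂(1 + p_j·g/σ²), t_i·log₂(1 + βj·p_i·c/σ²) }`,
is concave in `(p_j, p_i)` on `[0, ∞)²`. -/
theorem cee_numerator_concave (tj ti g c σ2 βj βi : ℝ)
    (htj : 0 < tj) (hti : 0 < ti) (hg : 0 < g) (hc : 0 < c) (hσ : 0 < σ2)
    (hβj : βj ∈ Set.Ioo (0 : ℝ) 1) (hβi : βi = 1 - βj) :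
    ConcaveOn ℝ {p : ℝ × ℝ | 0 ≤ p.1 ∧ 0 ≤ p.2}
      (fun p : ℝ × ℝ =>
        ti * Real.logb 2 (1 + βi * p.2 * c / (βj * p.2 * c + σ2)) +
          min (tj * Real.logb 2 (1 + p.1 * g / σ2))
            (ti * Real.logb 2 (1 + βj * p.2 * c / σ2))) := by
  obtain ⟨hβ0, hβ1⟩ := hβj
  have hβi0 : 0 < βi := by linarith
  have hs : Convex ℝ {p : ℝ × ℝ | 0 ≤ p.1 ∧ 0 ≤ p.2} :=
    ((convex_Ici (0 : ℝ)).prod (convex_Ici (0 : ℝ)))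
  have hcenter : ConcaveOn ℝ {p : ℝ × ℝ | 0 ≤ p.1 ∧ 0 ≤ p.2}
      (fun p => 1 + βi * p.2 * c / (βj * p.2 * c + σ2)) := by
    have h := (((concaveOn_div_mul_add (mul_pos hβ0 hc) hσ).comp_linearMap
      (LinearMap.snd ℝ ℝ ℝ)).subset (fun _ hp => hp.2) hs).smul (mul_pos hβi0 hc).le
    refine ((concaveOn_const 1 hs).add h).congr fun p _ => ?_
    simp only [Pi.add_apply, Function.comp_apply, LinearMap.snd_apply, smul_eq_mul]
    ring
  have hside : ConcaveOn ℝ {p : ℝ × ℝ | 0 ≤ p.1 ∧ 0 ≤ p.2} (fun p => 1 + p.1 * g / σ2) := by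
    refine ⟨hs, fun x _ y _ a b _ _ hab => le_of_eq ?_⟩
    simp only [smul_eq_mul, Prod.fst_add, Prod.smul_fst]
    linear_combination hab
  have hrelay : ConcaveOn ℝ {p : ℝ × ℝ | 0 ≤ p.1 ∧ 0 ≤ p.2}
      (fun p => 1 + βj * p.2 * c / σ2) := by
    refine ⟨hs, fun x _ y _ a b _ _ hab => le_of_eq ?_⟩
    simp only [smul_eq_mul, Prod.snd_add, Prod.smul_snd]
    linear_combination hab
  have hcenter' := (hcenter.logb_comp one_lt_two fun p ⟨_, hp⟩ => by positivity).smul hti.le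
  have hside' := (hside.logb_comp one_lt_two fun p ⟨hp, _⟩ => by positivity).smul htj.le
  have hrelay' := (hrelay.logb_comp one_lt_two fun p ⟨_, hp⟩ => by positivity).smul hti.le
  exact hcenter'.add (hside'.inf hrelay')
end

section
/- Fix t_j, t_i > 0, g, c, σ² > 0, β_j ∈ (0,1), and β_i = 1 − β_j, and let N(p_j, p_i) = t_i·log₂(1 + β_i·p_i·c/(β_j·p_i·c + σ²)) + min{ t_j·log₂(1 + p_j·g/σ²), t_i·log₂(1 + β_j·p_i·c/σ²) }. Then for every α ≥ 0 the superlevel set {(p_j, p_i) ∈ [0,∞)² : N(p_j, p_i) ≥ α·(t_j·p_j + t_i·p_i)} is convex; that is, the fractional objective N(p_j,p_i)/(t_j·p_j + t_i·p_i) of problem (P7)—a ratio of a concave numerator over a positive affine denominator—is quasi-concave on the positive orthant, which justifies solving (P7) by the Dinkelbach algorithm. -/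
theorem ConcaveOn.logb_of_pos {E : Type*} [AddCommMonoid E] [Module ℝ E] {s : Set E} {f : E → ℝ}
    {b : ℝ} (hb : 1 < b) (hf : ConcaveOn ℝ s f) (hpos : ∀ x ∈ s, 0 < f x) :
    ConcaveOn ℝ s (fun x => Real.logb b (f x)) := by
  refine ⟨hf.1, fun x hx y hy u v hu hv huv => ?_⟩
  have hlog := strictConcaveOn_log_Ioi.concaveOn.2 (hpos x hx) (hpos y hy) hu hv huv
  have hmid : 0 < u • f x + v • f y := convex_Ioi (0 : ℝ) (hpos x hx) (hpos y hy) hu hv huv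
  have hmono := Real.log_le_log hmid (hf.2 hx hy hu hv huv)
  have hb' : 0 < Real.log b := Real.log_pos hb
  simp only [Real.logb, smul_eq_mul] at hlog hmono ⊢
  rw [← mul_div_assoc, ← mul_div_assoc, ← add_div]
  exact div_le_div_of_nonneg_right (hlog.trans hmono) hb'.le

theorem concaveOn_one_add_mul_div_s14 {a b s : ℝ} (ha : 0 ≤ a) (hb : 0 ≤ b) (hs : 0 < s) :
    ConcaveOn ℝ (Set.Ici 0) (fun x : ℝ => 1 + a * x / (b * x + s)) := by
  refine ⟨convex_Ici 0, fun x hx y hy u v hu hv huv => ?_⟩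
  simp only [Set.mem_Ici, smul_eq_mul] at *
  obtain rfl : v = 1 - u := by linarith
  have hx' : 0 < b * x + s := by positivity
  have hy' : 0 < b * y + s := by positivity
  have hz' : 0 < b * (u * x + (1 - u) * y) + s := by positivity
  rw [← sub_nonneg]
  have key : 1 + a * (u * x + (1 - u) * y) / (b * (u * x + (1 - u) * y) + s) -
      (u * (1 + a * x / (b * x + s)) + (1 - u) * (1 + a * y / (b * y + s))) =
      a * b * s * u * (1 - u) * (x - y) ^ 2 /
        ((b * (u * x + (1 - u) * y) + s) * (b * x + s) * (b * y + s)) := by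
    field_simp
    ring
  rw [key]
  positivity

theorem concaveOn_logb_one_add_mul_div_s14 {a b s : ℝ} (ha : 0 ≤ a) (hb : 0 ≤ b) (hs : 0 < s) :
    ConcaveOn ℝ (Set.Ici 0) (fun x : ℝ => Real.logb 2 (1 + a * x / (b * x + s))) := by
  refine (concaveOn_one_add_mul_div_s14 ha hb hs).logb_of_pos one_lt_two fun x hx => ?_
  have hx' : 0 ≤ x := hx
  positivity


/-- Quasi-concavity of the fractional CEE objective of problem (P7): for every
`α ≥ 0`, the superlevel set
`{(p_j, p_i) ∈ [0,∞)² : N(p_j, p_i) ≥ α·(t_j·p_j + t_i·p_i)}` is convex, where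
`N` is the concave offloaded-bits numerator and `t_j·p_j + t_i·p_i` the energy. -/
theorem cee_objective_quasiconcave (tj ti g c σ2 βj βi : ℝ)
    (htj : 0 < tj) (hti : 0 < ti) (hg : 0 < g) (hc : 0 < c) (hσ : 0 < σ2)
    (hβj : βj ∈ Set.Ioo (0 : ℝ) 1) (hβi : βi = 1 - βj) :
    ∀ α : ℝ, 0 ≤ α →
      Convex ℝ {p : ℝ × ℝ | 0 ≤ p.1 ∧ 0 ≤ p.2 ∧
        ti * Real.logb 2 (1 + βi * p.2 * c / (βj * p.2 * c + σ2)) +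
            min (tj * Real.logb 2 (1 + p.1 * g / σ2))
              (ti * Real.logb 2 (1 + βj * p.2 * c / σ2)) ≥
          α * (tj * p.1 + ti * p.2)} := by
  obtain ⟨hβ0, hβ1⟩ := hβj
  intro α _
  have hβi0 : 0 ≤ βi := by linarith
  have hS : Convex ℝ (Set.Ici (0 : ℝ) ×ˢ Set.Ici (0 : ℝ)) := (convex_Ici 0).prod (convex_Ici 0)
  have hcenter := (((concaveOn_logb_one_add_mul_div_s14 (mul_nonneg hβi0 hc.le)
    (mul_nonneg hβ0.le hc.le) hσ).comp_linearMap (LinearMap.snd ℝ ℝ ℝ)).subset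
    (fun p hp => hp.2) hS).smul hti.le
  have hrelay := (((concaveOn_logb_one_add_mul_div_s14 (mul_nonneg hβ0.le hc.le)
    le_rfl hσ).comp_linearMap (LinearMap.snd ℝ ℝ ℝ)).subset
    (fun p hp => hp.2) hS).smul hti.le
  have hedge := (((concaveOn_logb_one_add_mul_div_s14 hg.le
    le_rfl hσ).comp_linearMap (LinearMap.fst ℝ ℝ ℝ)).subset
    (fun p hp => hp.1) hS).smul htj.le
  have henergy := (α • (tj • LinearMap.fst ℝ ℝ ℝ + ti • LinearMap.snd ℝ ℝ ℝ)).convexOn hS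
  refine (congrArg (Convex ℝ) (Set.ext ?_)).mpr
    (((hcenter.add (hedge.inf hrelay)).sub henergy).convex_ge 0)
  rintro ⟨x, y⟩
  simp [and_assoc, mul_add, mul_right_comm _ c, mul_comm g]
end

section
/- Let t, W, c, σ² > 0, L > 0, β_j ∈ (0,1), and β_i = 1 − β_j. There exists p > 0 with t·W·log₂(1 + β_i·p·c/(β_j·p·c + σ²)) ≥ L if and only if β_j·2^{L/(t·W)} < 1 (equivalently β_i/β_j > 2^{L/(t·W)} − 1); and in that case the smallest such p equals (2^{L/(t·W)} − 1)·σ² / ((1 − β_j·2^{L/(t·W)})·c), which is the lower bound on the beam gain/power appearing in constraints (41) and (48) of the beamforming problem (P10)/(P11). -/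
/-- At positive power, the rate requirement is a linear inequality in the power. -/
theorem le_rate_iff_of_pos {t W c σ2 L βj p : ℝ}
    (ht : 0 < t) (hW : 0 < W) (hc : 0 < c) (hσ : 0 < σ2)
    (hβj : βj ∈ Set.Ioo (0 : ℝ) 1) (hp : 0 < p) :
    L ≤ t * W * Real.logb 2 (1 + (1 - βj) * p * c / (βj * p * c + σ2)) ↔
      ((2 : ℝ) ^ (L / (t * W)) - 1) * σ2 ≤ p * ((1 - βj * (2 : ℝ) ^ (L / (t * W))) * c) := by
  obtain ⟨h0, h1⟩ := hβj
  have hden : 0 < βj * p * c + σ2 := by positivity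
  have hsinr : 1 + (1 - βj) * p * c / (βj * p * c + σ2) = (p * c + σ2) / (βj * p * c + σ2) := by
    field_simp
    ring
  have hpos : 0 < (p * c + σ2) / (βj * p * c + σ2) := by positivity
  rw [hsinr, ← div_le_iff₀' (by positivity), Real.le_logb_iff_rpow_le one_lt_two hpos,
    le_div_iff₀ hden]
  constructor <;> intro h <;> linarith


/-- Feasibility of the cell-center user's full-offloading requirement through the
SIC-decoded SINR: a power `p > 0` with
`t·W·log₂(1 + βi·p·c/(βj·p·c + σ²)) ≥ L` exists iff `βj·2^{L/(t·W)} < 1`, and the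
smallest feasible `p` is then `(2^{L/(t·W)} − 1)·σ² / ((1 − βj·2^{L/(t·W)})·c)`. -/
theorem sinr_feasibility_and_min_power (t W c σ2 L βj βi : ℝ)
    (ht : 0 < t) (hW : 0 < W) (hc : 0 < c) (hσ : 0 < σ2) (hL : 0 < L)
    (hβj : βj ∈ Set.Ioo (0 : ℝ) 1) (hβi : βi = 1 - βj) :
    ((∃ p : ℝ, 0 < p ∧
        t * W * Real.logb 2 (1 + βi * p * c / (βj * p * c + σ2)) ≥ L) ↔
      βj * (2 : ℝ) ^ (L / (t * W)) < 1) ∧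
    (βj * (2 : ℝ) ^ (L / (t * W)) < 1 →
      IsLeast {p : ℝ | 0 < p ∧
          t * W * Real.logb 2 (1 + βi * p * c / (βj * p * c + σ2)) ≥ L}
        (((2 : ℝ) ^ (L / (t * W)) - 1) * σ2 /
          ((1 - βj * (2 : ℝ) ^ (L / (t * W))) * c))) := by
  subst hβi
  have hK : 1 < (2 : ℝ) ^ (L / (t * W)) := Real.one_lt_rpow one_lt_two (by positivity)
  have hnum : 0 < ((2 : ℝ) ^ (L / (t * W)) - 1) * σ2 := mul_pos (sub_pos.2 hK) hσ
  have hleast : βj * (2 : ℝ) ^ (L / (t * W)) < 1 →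
      IsLeast {p : ℝ | 0 < p ∧
          t * W * Real.logb 2 (1 + (1 - βj) * p * c / (βj * p * c + σ2)) ≥ L}
        (((2 : ℝ) ^ (L / (t * W)) - 1) * σ2 /
          ((1 - βj * (2 : ℝ) ^ (L / (t * W))) * c)) := by
    intro h
    have hden : 0 < (1 - βj * (2 : ℝ) ^ (L / (t * W))) * c := mul_pos (sub_pos.2 h) hc
    have hmin := div_pos hnum hden
    refine ⟨⟨hmin, (le_rate_iff_of_pos ht hW hc hσ hβj hmin).2 ?_⟩, ?_⟩
    · rw [div_mul_cancel₀ _ hden.ne']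
    · rintro p ⟨hp, hrate⟩
      exact (div_le_iff₀ hden).2 ((le_rate_iff_of_pos ht hW hc hσ hβj hp).1 hrate)
  refine ⟨⟨?_, fun h => ⟨_, (hleast h).1⟩⟩, hleast⟩
  rintro ⟨p, hp, hrate⟩
  have hprod := hnum.trans_le ((le_rate_iff_of_pos ht hW hc hσ hβj hp).1 hrate)
  exact sub_pos.1 (pos_of_mul_pos_left (pos_of_mul_pos_right hprod hp.le) hc.le)
end

section
/- Let C > 0, γ_j, γ_i > 0, a_j, a_i > 0, and T' > 0, and define the pair CEE under minimal-energy power allocation as η(t_j, t_i) = C / ( γ_j·t_j·(2^{a_j/t_j} − 1) + γ_i·t_i·(2^{a_i/t_i} − 1) ) for t_j, t_i > 0. Then η is strictly increasing in each of t_j and t_i; consequently, any maximizer of η over the set {(t_j, t_i) : t_j, t_i > 0, t_j + t_i ≤ T'} satisfies t_j + t_i = T', i.e., the latency constraint is active at the optimum of the CEE maximization, as asserted in the time-allocation step of the solution of (P4). -/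
/-- The perspective `t * (b ^ (a / t) - 1)` of an exponential is strictly decreasing in `t`. -/
theorem strictAntiOn_mul_rpow_div_sub_one {b a : ℝ} (hb : 1 < b) (ha : 0 < a) :
    StrictAntiOn (fun t : ℝ => t * (b ^ (a / t) - 1)) (Set.Ioi 0) := by
  intro s hs t ht hst
  rw [Set.mem_Ioi] at hs ht
  have hx : 1 < b ^ (a / t) := Real.one_lt_rpow hb (div_pos ha ht)
  have bernoulli : 1 + t / s * (b ^ (a / t) - 1) < (1 + (b ^ (a / t) - 1)) ^ (t / s) :=
    one_add_mul_self_lt_rpow_one_add (by linarith) (by linarith) ((one_lt_div hs).2 hst)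
  have hpow : (1 + (b ^ (a / t) - 1)) ^ (t / s) = b ^ (a / s) := by
    rw [add_sub_cancel, ← Real.rpow_mul (by linarith)]
    congr 1
    field_simp
  rw [hpow] at bernoulli
  calc t * (b ^ (a / t) - 1) = s * (t / s * (b ^ (a / t) - 1)) := by field_simp
    _ < s * (b ^ (a / s) - 1) := by gcongr; linarith

theorem mul_mul_rpow_div_sub_one_pos {γ b a t : ℝ} (hγ : 0 < γ) (hb : 1 < b) (ha : 0 < a)
    (ht : 0 < t) : 0 < γ * t * (b ^ (a / t) - 1) :=
  mul_pos (mul_pos hγ ht) (sub_pos.2 (Real.one_lt_rpow hb (div_pos ha ht)))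

/-- A positive constant divided by a transmission energy plus a positive constant is strictly
increasing in the transmission time. -/
theorem strictMonoOn_div_mul_rpow_div_sub_one_add {C γ b a e : ℝ} (hC : 0 < C) (hγ : 0 < γ)
    (hb : 1 < b) (ha : 0 < a) (he : 0 < e) :
    StrictMonoOn (fun t : ℝ => C / (γ * t * (b ^ (a / t) - 1) + e)) (Set.Ioi 0) := by
  intro s hs t ht hst
  have hpos := mul_mul_rpow_div_sub_one_pos hγ hb ha ht
  have hlt := mul_lt_mul_of_pos_left (strictAntiOn_mul_rpow_div_sub_one hb ha hs ht hst) hγ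
  simp only [← mul_assoc] at hlt
  exact div_lt_div_of_pos_left hC (by linarith) (by linarith)


/-- The pair CEE under minimal-energy power allocation,
`η(t_j, t_i) = C / (γ_j·t_j·(2^{a_j/t_j} − 1) + γ_i·t_i·(2^{a_i/t_i} − 1))`,
is strictly increasing in each of `t_j` and `t_i`; consequently any maximizer of
`η` over `{(t_j, t_i) : t_j, t_i > 0, t_j + t_i ≤ T'}` satisfies `t_j + t_i = T'`,
i.e., the latency constraint is active at the optimum of (P4). -/
theorem cee_latency_constraint_active (C γj γi aj ai T' : ℝ)
    (hC : 0 < C) (hγj : 0 < γj) (hγi : 0 < γi) (haj : 0 < aj) (hai : 0 < ai)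
    (hT : 0 < T') :
    (∀ ti : ℝ, 0 < ti → StrictMonoOn
        (fun tj : ℝ => C / (γj * tj * ((2 : ℝ) ^ (aj / tj) - 1) +
          γi * ti * ((2 : ℝ) ^ (ai / ti) - 1))) (Set.Ioi 0)) ∧
    (∀ tj : ℝ, 0 < tj → StrictMonoOn
        (fun ti : ℝ => C / (γj * tj * ((2 : ℝ) ^ (aj / tj) - 1) +
          γi * ti * ((2 : ℝ) ^ (ai / ti) - 1))) (Set.Ioi 0)) ∧
    (∀ tj ti : ℝ, 0 < tj → 0 < ti → tj + ti ≤ T' →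
      (∀ tj' ti' : ℝ, 0 < tj' → 0 < ti' → tj' + ti' ≤ T' →
        C / (γj * tj' * ((2 : ℝ) ^ (aj / tj') - 1) +
            γi * ti' * ((2 : ℝ) ^ (ai / ti') - 1)) ≤
          C / (γj * tj * ((2 : ℝ) ^ (aj / tj) - 1) +
            γi * ti * ((2 : ℝ) ^ (ai / ti) - 1))) →
      tj + ti = T') := by
  have mono_j : ∀ ti : ℝ, 0 < ti → StrictMonoOn
      (fun tj : ℝ => C / (γj * tj * ((2 : ℝ) ^ (aj / tj) - 1) +
        γi * ti * ((2 : ℝ) ^ (ai / ti) - 1))) (Set.Ioi 0) := fun ti hti =>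
    strictMonoOn_div_mul_rpow_div_sub_one_add hC hγj one_lt_two haj
      (mul_mul_rpow_div_sub_one_pos hγi one_lt_two hai hti)
  refine ⟨mono_j, fun tj htj => ?_, fun tj ti htj hti hle hmax => ?_⟩
  · simpa only [add_comm] using strictMonoOn_div_mul_rpow_div_sub_one_add hC hγi one_lt_two hai
      (mul_mul_rpow_div_sub_one_pos hγj one_lt_two haj htj)
  · by_contra hne
    have hlt : tj < T' - ti := by linarith [lt_of_le_of_ne hle hne]
    have hpos : 0 < T' - ti := htj.trans hlt
    exact (hmax (T' - ti) ti hpos hti (by linarith)).not_gt (mono_j ti hti htj hpos hlt)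
end
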